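/- For each i ∈ {1,2,3,4}, all real μ, ν, and all 0 < t < 1, x > 0, the function u(t,x) = G_i^{μ,ν}(t,x) satisfies the partial differential equation (D_{μ,ν})_x u(t,x) = 4·θ_t(θ_t + μ + 1)u(t,x), where D_{μ,ν} acts in the variable x and θ_t = t·(∂/∂t). -/

import Mathlib

noncomputable section

open Set MeasureTheory Filter Topology

/-- The Euler operator `θ = x·d/dx` acting on real-valued functions on `ℝ`. -/
def eulerOp (u : ℝ → ℝ) : ℝ → ℝ := fun x => x * deriv u x

/-- The operator `(θ + a)(θ + b) − x²` applied to `v`. -/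
def quadOp (a b : ℝ) (v : ℝ → ℝ) : ℝ → ℝ := fun x =>
  eulerOp (fun y => eulerOp v y + b * v y) x
    + a * (eulerOp v x + b * v x) - x ^ 2 * v x

/-- The fourth-order operator `D_{μ,ν} = x⁻²((θ+μ+ν)(θ+μ) − x²)(θ(θ+ν) − x²)`. -/
def Dop (μ ν : ℝ) (u : ℝ → ℝ) : ℝ → ℝ := fun x =>
  quadOp (μ + ν) μ (quadOp 0 ν u) x / x ^ 2

/-- The normalized I-Bessel function `Ĩ_α(z) = Σ (z/2)^{2n}/(n!·Γ(n+α+1))`. -/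
def tildeI (α z : ℝ) : ℝ :=
  ∑' n : ℕ, (z / 2) ^ (2 * n) / ((n.factorial : ℝ) * Real.Gamma ((n : ℝ) + α + 1))

/-- The K-Bessel function `K_α(z) = ∫₀^∞ e^{−z·cosh s}·cosh(α·s) ds`. -/
def besselK (α z : ℝ) : ℝ :=
  ∫ s in Ioi (0 : ℝ), Real.exp (-z * Real.cosh s) * Real.cosh (α * s)

/-- The normalized K-Bessel function `K̃_α(z) = (z/2)^{−α}·K_α(z)`. -/
def tildeK (α z : ℝ) : ℝ := (z / 2) ^ (-α) * besselK α z

/-- The generating function `G₁^{μ,ν}(t,x)`. -/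
def genG₁ (μ ν t x : ℝ) : ℝ :=
  (1 - t) ^ (-(μ + ν + 2) / 2) * tildeI (μ / 2) (t * x / (1 - t)) * tildeI (ν / 2) (x / (1 - t))

/-- The generating function `G₂^{μ,ν}(t,x)`. -/
def genG₂ (μ ν t x : ℝ) : ℝ :=
  (1 - t) ^ (-(μ + ν + 2) / 2) * tildeI (μ / 2) (t * x / (1 - t)) * tildeK (ν / 2) (x / (1 - t))

/-- The generating function `G₃^{μ,ν}(t,x)`. -/
def genG₃ (μ ν t x : ℝ) : ℝ :=
  (1 - t) ^ (-(μ + ν + 2) / 2) * tildeK (μ / 2) (t * x / (1 - t)) * tildeI (ν / 2) (x / (1 - t))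

/-- The generating function `G₄^{μ,ν}(t,x)`. -/
def genG₄ (μ ν t x : ℝ) : ℝ :=
  (1 - t) ^ (-(μ + ν + 2) / 2) * tildeK (μ / 2) (t * x / (1 - t)) * tildeK (ν / 2) (x / (1 - t))

/-- `Λ₁ⱼ^{μ,ν}(x) = (1/j!)·(∂/∂t)^j|₀ G₁^{μ,ν}(t,x)`. -/
def Lambda₁ (μ ν : ℝ) (j : ℕ) (x : ℝ) : ℝ :=
  iteratedDeriv j (fun t => genG₁ μ ν t x) 0 / (j.factorial : ℝ)

/-- `Λ₂ⱼ^{μ,ν}(x) = (1/j!)·(∂/∂t)^j|₀ G₂^{μ,ν}(t,x)`. -/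
def Lambda₂ (μ ν : ℝ) (j : ℕ) (x : ℝ) : ℝ :=
  iteratedDeriv j (fun t => genG₂ μ ν t x) 0 / (j.factorial : ℝ)

/-- `Λ₁ⱼ` for integer `j`, vanishing for `j < 0`. -/
def Lambda₁Z (μ ν : ℝ) (j : ℤ) (x : ℝ) : ℝ :=
  if 0 ≤ j then Lambda₁ μ ν j.toNat x else 0

/-- `Λ₂ⱼ` for integer `j`, vanishing for `j < 0`. -/
def Lambda₂Z (μ ν : ℝ) (j : ℤ) (x : ℝ) : ℝ :=
  if 0 ≤ j then Lambda₂ μ ν j.toNat x else 0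

/-- For `μ = m` a positive odd integer, `Λ₃ⱼ^{μ,ν}(x) = (1/(j+μ)!)·(∂/∂t)^{j+μ}|₀ [tᵐ·G₃]`,
the derivative at `0` being the limit from the right of the `(j+μ)`-th derivative of the
real-analytic function `t ↦ tᵐ·G₃^{m,ν}(t,x)` on `(0,1)`; it vanishes for `j < −μ`. -/
def Lambda₃ (m : ℕ) (ν : ℝ) (j : ℤ) (x : ℝ) : ℝ :=
  if -(m : ℤ) ≤ j then
    limUnder (𝓝[>] (0 : ℝ))
        (fun t => iteratedDeriv (j + (m : ℤ)).toNat (fun s => s ^ m * genG₃ (m : ℝ) ν s x) t) /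
      (((j + (m : ℤ)).toNat.factorial : ℝ))
  else 0

/-- For `μ = m` a positive odd integer, `Λ₄ⱼ^{μ,ν}(x) = (1/(j+μ)!)·(∂/∂t)^{j+μ}|₀ [tᵐ·G₄]`,
vanishing for `j < −μ`. -/
def Lambda₄ (m : ℕ) (ν : ℝ) (j : ℤ) (x : ℝ) : ℝ :=
  if -(m : ℤ) ≤ j then
    limUnder (𝓝[>] (0 : ℝ))
        (fun t => iteratedDeriv (j + (m : ℤ)).toNat (fun s => s ^ m * genG₄ (m : ℝ) ν s x) t) /
      (((j + (m : ℤ)).toNat.factorial : ℝ))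
  else 0

/-- `A` is differentiable on `(0,∞)` with Euler derivative `A₁ = θA`, and it solves the
normalized modified Bessel equation `θ(θ + m)A = z²A`. -/
structure IsNormalizedBessel (m : ℝ) (A A₁ : ℝ → ℝ) : Prop where
  hasDerivAt : ∀ z, 0 < z → HasDerivAt A (A₁ z / z) z
  hasDerivAt_euler : ∀ z, 0 < z → HasDerivAt A₁ ((z ^ 2 * A z - m * A₁ z) / z) z

/-! ### The normalized I-Bessel function -/

/-- The entire series `Σ wⁿ/(n!·Γ(n+α+1))`, with `Ĩ_α(z)` its value at `w = z²/4`. -/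
def besselSeries (α w : ℝ) : ℝ :=
  ∑' n : ℕ, w ^ n / ((n.factorial : ℝ) * Real.Gamma ((n : ℝ) + α + 1))

theorem tildeI_eq_besselSeries (α z : ℝ) : tildeI α z = besselSeries α (z ^ 2 / 4) := by
  unfold tildeI besselSeries
  refine tsum_congr fun n => ?_
  rw [pow_mul]
  congr 2
  ring

theorem summable_besselSeries (α w : ℝ) :
    Summable fun n : ℕ => w ^ n / ((n.factorial : ℝ) * Real.Gamma ((n : ℝ) + α + 1)) := by
  rcases eq_or_ne w 0 with rfl | hw
  · refine summable_of_ne_finset_zero (s := {0}) fun n hn => ?_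
    have : n ≠ 0 := by simpa using hn
    simp [this]
  have hpos : ∀ᶠ n : ℕ in atTop, 0 < (n : ℝ) + α + 1 := by
    filter_upwards [tendsto_natCast_atTop_atTop.eventually_gt_atTop (-α - 1)] with n hn
    linarith
  refine summable_of_ratio_test_tendsto_lt_one (l := 0) zero_lt_one ?_ ?_
  · filter_upwards [hpos] with n hn
    have := (Real.Gamma_pos_of_pos hn).ne'
    positivity
  · have h1 : Tendsto (fun n : ℕ => (n : ℝ) + 1) atTop atTop :=
      tendsto_atTop_add_const_right _ _ tendsto_natCast_atTop_atTop
    have h2 : Tendsto (fun n : ℕ => (n : ℝ) + α + 1) atTop atTop :=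
      tendsto_atTop_add_const_right _ _
        (tendsto_atTop_add_const_right _ _ tendsto_natCast_atTop_atTop)
    refine ((h1.atTop_mul_atTop₀ h2).const_div_atTop |w|).congr' ?_
    filter_upwards [hpos] with n hn
    have hG := Real.Gamma_pos_of_pos hn
    have hs : Real.Gamma (((n + 1 : ℕ) : ℝ) + α + 1)
        = ((n : ℝ) + α + 1) * Real.Gamma ((n : ℝ) + α + 1) := by
      rw [← Real.Gamma_add_one hn.ne']
      congr 1
      push_cast
      ring
    rw [hs, Nat.factorial_succ]
    simp only [norm_div, norm_mul, norm_pow, Real.norm_eq_abs, Nat.abs_cast, abs_of_pos hn,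
      abs_of_pos hG]
    have : 0 < |w| := abs_pos.mpr hw
    push_cast
    rw [pow_succ]
    field_simp

theorem hasDerivAt_besselSeries (α w : ℝ) :
    HasDerivAt (besselSeries α) (besselSeries (α + 1) w) w := by
  have hshift : ∀ (v : ℝ) (n : ℕ),
      ((n + 1 : ℕ) : ℝ) * v ^ (n + 1 - 1) /
        (((n + 1).factorial : ℝ) * Real.Gamma (((n + 1 : ℕ) : ℝ) + α + 1))
      = v ^ n / ((n.factorial : ℝ) * Real.Gamma ((n : ℝ) + (α + 1) + 1)) := by
    intro v n
    rw [show ((n + 1 : ℕ) : ℝ) + α + 1 = (n : ℝ) + (α + 1) + 1 by push_cast; ring,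
      Nat.factorial_succ, Nat.cast_mul, mul_assoc, Nat.add_sub_cancel]
    exact mul_div_mul_left _ _ (by positivity)
  have hsum : ∀ v : ℝ, Summable fun n : ℕ =>
      (n : ℝ) * v ^ (n - 1) / ((n.factorial : ℝ) * Real.Gamma ((n : ℝ) + α + 1)) := by
    intro v
    rw [← summable_nat_add_iff 1]
    simpa only [hshift] using summable_besselSeries (α + 1) v
  have hderiv := hasDerivAt_tsum_of_isPreconnected (𝕜 := ℝ)
    (g := fun (n : ℕ) v => v ^ n / ((n.factorial : ℝ) * Real.Gamma ((n : ℝ) + α + 1)))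
    (g' := fun (n : ℕ) v =>
      (n : ℝ) * v ^ (n - 1) / ((n.factorial : ℝ) * Real.Gamma ((n : ℝ) + α + 1)))
    (t := Metric.ball (0 : ℝ) (|w| + 1)) (y₀ := w) (y := w)
    (hsum (|w| + 1)).norm Metric.isOpen_ball (convex_ball _ _).isPreconnected
    (fun n v _ => (hasDerivAt_pow n v).div_const _) (fun n v hv => ?_) (by simp)
    (summable_besselSeries α w) (by simp)
  · refine hderiv.congr_deriv ?_
    rw [(hsum w).tsum_eq_zero_add]
    simp only [hshift]
    simp [besselSeries]
  · have hv' : |v| ≤ |(|w| + 1)| := by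
      rw [abs_of_pos (by positivity : 0 < |w| + 1)]
      simpa using (mem_ball_zero_iff.mp hv).le
    simp only [norm_div, norm_mul, norm_pow, Real.norm_eq_abs]
    gcongr

theorem besselSeries_recurrence (α w : ℝ) :
    w * besselSeries (α + 2) w + (α + 1) * besselSeries (α + 1) w = besselSeries α w := by
  have hterm : ∀ n : ℕ, (n + 1 + α) / ((n.factorial : ℝ) * Real.Gamma ((n : ℝ) + (α + 1) + 1))
      = 1 / ((n.factorial : ℝ) * Real.Gamma ((n : ℝ) + α + 1)) := by
    intro n
    rcases eq_or_ne ((n : ℝ) + α + 1) 0 with h | h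
    · rw [h, show (n : ℝ) + 1 + α = 0 by linarith]
      simp
    · rw [show (n : ℝ) + (α + 1) + 1 = (n : ℝ) + α + 1 + 1 by ring, Real.Gamma_add_one h,
        show (n : ℝ) + 1 + α = (n : ℝ) + α + 1 by ring, mul_left_comm]
      simpa using mul_div_mul_left (1 : ℝ) ((n.factorial : ℝ) * Real.Gamma ((n : ℝ) + α + 1)) h
  have hshift : ∀ n : ℕ, w * (w ^ n / ((n.factorial : ℝ) * Real.Gamma ((n : ℝ) + (α + 2) + 1)))
      = ((n + 1 : ℕ) : ℝ) * (w ^ (n + 1) /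
        (((n + 1).factorial : ℝ) * Real.Gamma (((n + 1 : ℕ) : ℝ) + (α + 1) + 1))) := by
    intro n
    rw [show ((n + 1 : ℕ) : ℝ) + (α + 1) + 1 = (n : ℝ) + (α + 2) + 1 by push_cast; ring,
      Nat.factorial_succ, Nat.cast_mul, mul_assoc, ← mul_div_assoc, ← mul_div_assoc,
      mul_div_mul_left _ _ (by positivity : ((n + 1 : ℕ) : ℝ) ≠ 0), pow_succ']
  have hs : Summable fun n : ℕ => (n : ℝ) * (w ^ n /
      ((n.factorial : ℝ) * Real.Gamma ((n : ℝ) + (α + 1) + 1))) := by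
    rw [← summable_nat_add_iff 1]
    simpa only [hshift] using (summable_besselSeries (α + 2) w).mul_left w
  have h1 : w * besselSeries (α + 2) w = ∑' n : ℕ, (n : ℝ) * (w ^ n /
      ((n.factorial : ℝ) * Real.Gamma ((n : ℝ) + (α + 1) + 1))) := by
    rw [hs.tsum_eq_zero_add]
    simp only [← hshift]
    rw [besselSeries, ← tsum_mul_left]
    simp
  rw [h1]
  unfold besselSeries
  rw [← tsum_mul_left, ← hs.tsum_add ((summable_besselSeries (α + 1) w).mul_left _)]
  refine tsum_congr fun n => ?_
  linear_combination w ^ n * hterm n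

theorem isNormalizedBessel_tildeI (m : ℝ) :
    IsNormalizedBessel m (tildeI (m / 2))
      (fun z => z ^ 2 / 2 * besselSeries (m / 2 + 1) (z ^ 2 / 4)) := by
  have hsq : ∀ z : ℝ, HasDerivAt (fun z : ℝ => z ^ 2 / 4) (z / 2) z := fun z =>
    ((hasDerivAt_pow 2 z).div_const 4).congr_deriv (by norm_num; ring)
  have hcomp : ∀ α z : ℝ, HasDerivAt (fun z : ℝ => besselSeries α (z ^ 2 / 4))
      (besselSeries (α + 1) (z ^ 2 / 4) * (z / 2)) z := fun α z =>
    HasDerivAt.comp (h₂ := besselSeries α) z (hasDerivAt_besselSeries α (z ^ 2 / 4)) (hsq z)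
  constructor
  · intro z hz
    rw [funext (tildeI_eq_besselSeries (m / 2))]
    refine (hcomp (m / 2) z).congr_deriv ?_
    field_simp
  · intro z hz
    refine (((hasDerivAt_pow 2 z).div_const 2).mul (hcomp (m / 2 + 1) z)).congr_deriv ?_
    rw [tildeI_eq_besselSeries, ← besselSeries_recurrence (m / 2) (z ^ 2 / 4),
      show m / 2 + 1 + 1 = m / 2 + 2 by ring]
    field_simp
    push_cast
    ring

/-! ### The normalized K-Bessel function -/

theorem exp_neg_mul_cosh_mul_exp_le {z s : ℝ} (hz : 0 < z) (hs : 0 ≤ s) (c : ℝ) :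
    Real.exp (-z * Real.cosh s) * Real.exp (c * s)
      ≤ Real.exp ((c + 1) ^ 2 / z) * Real.exp (-1 * s) := by
  rw [← Real.exp_add, ← Real.exp_add, Real.exp_le_exp]
  have hcosh : s ^ 2 / 4 ≤ Real.cosh s := by
    have h1 := Real.quadratic_le_exp_of_nonneg hs
    have h2 := Real.exp_pos (-s)
    rw [Real.cosh_eq]
    linarith
  have hmul := mul_le_mul_of_nonneg_left hcosh hz.le
  have hsquare : 0 ≤ z * (s / 2 - (c + 1) / z) ^ 2 := by positivity
  have hexpand : z * (s / 2 - (c + 1) / z) ^ 2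
      = z * (s ^ 2 / 4) - (c + 1) * s + (c + 1) ^ 2 / z := by
    field_simp
    ring
  linarith

theorem isBigO_exp_neg_of_le_exp_neg_cosh {z c : ℝ} (hz : 0 < z) {f : ℝ → ℝ}
    (hf : ∀ s, 0 ≤ s → |f s| ≤ Real.exp (-z * Real.cosh s) * Real.exp (c * s)) :
    f =O[atTop] fun s => Real.exp (-1 * s) := by
  refine Asymptotics.IsBigO.of_bound (Real.exp ((c + 1) ^ 2 / z)) ?_
  filter_upwards [eventually_ge_atTop (0 : ℝ)] with s hs
  rw [Real.norm_eq_abs, Real.norm_eq_abs, Real.abs_exp]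
  exact (hf s hs).trans (exp_neg_mul_cosh_mul_exp_le hz hs c)

theorem cosh_le_exp_of_nonneg {s : ℝ} (hs : 0 ≤ s) : Real.cosh s ≤ Real.exp s := by
  rw [Real.cosh_eq]
  have : Real.exp (-s) ≤ Real.exp s := Real.exp_le_exp.mpr (by linarith)
  linarith

theorem cosh_mul_le_exp (α : ℝ) {s : ℝ} (hs : 0 ≤ s) :
    Real.cosh (α * s) ≤ Real.exp (|α| * s) := by
  rw [← Real.cosh_abs, abs_mul, abs_of_nonneg hs]
  exact cosh_le_exp_of_nonneg (by positivity)

theorem abs_sinh_le_cosh (s : ℝ) : |Real.sinh s| ≤ Real.cosh s := by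
  rw [abs_le]
  constructor
  · rw [Real.cosh_eq, Real.sinh_eq]
    linarith [Real.exp_pos s]
  · exact (Real.sinh_lt_cosh s).le

/-- The integrand of the `k`-th `z`-derivative of `K_α`, up to sign. -/
def besselKIntegrand (α : ℝ) (k : ℕ) (z s : ℝ) : ℝ :=
  Real.exp (-z * Real.cosh s) * Real.cosh s ^ k * Real.cosh (α * s)

/-- The `k`-th derivative of `K_α`, up to sign. -/
def besselKMoment (α : ℝ) (k : ℕ) (z : ℝ) : ℝ :=
  ∫ s in Ioi (0 : ℝ), besselKIntegrand α k z s

theorem besselK_eq_besselKMoment (α z : ℝ) : besselK α z = besselKMoment α 0 z := by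
  simp [besselK, besselKMoment, besselKIntegrand]

theorem continuous_besselKIntegrand (α : ℝ) (k : ℕ) (z : ℝ) :
    Continuous (besselKIntegrand α k z) := by
  unfold besselKIntegrand
  fun_prop

theorem exp_mul_cosh_pow_mul_cosh_le (α : ℝ) (k : ℕ) (z : ℝ) {s : ℝ} (hs : 0 ≤ s) :
    Real.exp (-z * Real.cosh s) * Real.cosh s ^ k * Real.cosh (α * s)
      ≤ Real.exp (-z * Real.cosh s) * Real.exp ((k + |α|) * s) := by
  rw [mul_assoc, add_mul, Real.exp_add, Real.exp_nat_mul]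
  gcongr
  · exact cosh_le_exp_of_nonneg hs
  · exact cosh_mul_le_exp α hs

theorem besselKIntegrand_nonneg (α : ℝ) (k : ℕ) (z s : ℝ) : 0 ≤ besselKIntegrand α k z s := by
  have h1 := Real.cosh_pos s
  have h2 := Real.cosh_pos (α * s)
  unfold besselKIntegrand
  positivity

theorem integrableOn_besselKIntegrand (α : ℝ) (k : ℕ) {z : ℝ} (hz : 0 < z) :
    IntegrableOn (besselKIntegrand α k z) (Ioi 0) := by
  refine integrable_of_isBigO_exp_neg zero_lt_one
    (continuous_besselKIntegrand α k z).continuousOn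
    (isBigO_exp_neg_of_le_exp_neg_cosh (c := k + |α|) hz fun s hs => ?_)
  rw [abs_of_nonneg (besselKIntegrand_nonneg α k z s)]
  exact exp_mul_cosh_pow_mul_cosh_le α k z hs

theorem hasDerivAt_besselKMoment (α : ℝ) (k : ℕ) {z : ℝ} (hz : 0 < z) :
    HasDerivAt (besselKMoment α k) (-besselKMoment α (k + 1) z) z := by
  have h := (hasDerivAt_integral_of_dominated_loc_of_deriv_le (μ := volume.restrict (Ioi 0))
    (F := besselKIntegrand α k) (F' := fun y s => -besselKIntegrand α (k + 1) y s)
    (bound := besselKIntegrand α (k + 1) (z / 2)) (s := Ioi (z / 2)) (x₀ := z)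
    (Ioi_mem_nhds (by linarith))
    (Eventually.of_forall fun y => (continuous_besselKIntegrand α k y).aestronglyMeasurable)
    (integrableOn_besselKIntegrand α k hz)
    (continuous_besselKIntegrand α (k + 1) z).neg.aestronglyMeasurable
    (Eventually.of_forall fun s y hy => ?_)
    (integrableOn_besselKIntegrand α (k + 1) (half_pos hz))
    (Eventually.of_forall fun s y _ => ?_)).2
  · rwa [integral_neg] at h
  · rw [norm_neg, Real.norm_eq_abs, abs_of_nonneg (besselKIntegrand_nonneg _ _ _ _)]
    have h1 := Real.cosh_pos s
    have h2 := Real.cosh_pos (α * s)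
    have h3 : z / 2 ≤ y := le_of_lt hy
    unfold besselKIntegrand
    gcongr
  · unfold besselKIntegrand
    refine (((((hasDerivAt_id y).neg.mul_const (Real.cosh s)).exp).mul_const
      (Real.cosh s ^ k)).mul_const (Real.cosh (α * s))).congr_deriv ?_
    simp only [Pi.neg_apply, id]
    ring_nf

theorem besselKMoment_recurrence (α : ℝ) {z : ℝ} (hz : 0 < z) :
    z ^ 2 * besselKMoment α 2 z - z * besselKMoment α 1 z
      = (z ^ 2 + α ^ 2) * besselKMoment α 0 z := by
  have hint := fun k => integrableOn_besselKIntegrand α k hz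
  have hderiv : ∀ s : ℝ, HasDerivAt
      (fun s => -z * (Real.exp (-z * Real.cosh s) * Real.sinh s * Real.cosh (α * s))
        - α * (Real.exp (-z * Real.cosh s) * Real.sinh (α * s)))
      (z ^ 2 * besselKIntegrand α 2 z s - z * besselKIntegrand α 1 z s
        - (z ^ 2 + α ^ 2) * besselKIntegrand α 0 z s) s := by
    intro s
    have he := ((Real.hasDerivAt_cosh s).const_mul (-z)).exp
    have hm : HasDerivAt (fun s : ℝ => α * s) α s := by
      simpa using (hasDerivAt_id s).const_mul α
    refine ((((he.mul (Real.hasDerivAt_sinh s)).mul hm.cosh).const_mul (-z)).sub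
      ((he.mul hm.sinh).const_mul α)).congr_deriv ?_
    have hsq := Real.cosh_sq s
    unfold besselKIntegrand
    simp only [Pi.mul_apply]
    linear_combination (-z ^ 2 * Real.exp (-z * Real.cosh s) * Real.cosh (α * s)) * hsq
  have hdecay : ∀ f : ℝ → ℝ, ∀ c : ℝ,
      (∀ s, 0 ≤ s → |f s| ≤ Real.exp (-z * Real.cosh s) * Real.exp (c * s)) →
      Tendsto f atTop (𝓝 0) := by
    intro f c hf
    refine (isBigO_exp_neg_of_le_exp_neg_cosh hz hf).trans_tendsto ?_
    simpa using Real.tendsto_exp_neg_atTop_nhds_zero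
  have htend : Tendsto
      (fun s => -z * (Real.exp (-z * Real.cosh s) * Real.sinh s * Real.cosh (α * s))
        - α * (Real.exp (-z * Real.cosh s) * Real.sinh (α * s))) atTop (𝓝 0) := by
    have h1 := hdecay (fun s => Real.exp (-z * Real.cosh s) * Real.sinh s * Real.cosh (α * s))
      ((1 : ℕ) + |α|) fun s hs => by
        refine le_trans ?_ (exp_mul_cosh_pow_mul_cosh_le α 1 z hs)
        rw [abs_mul, abs_mul, Real.abs_exp, abs_of_pos (Real.cosh_pos (α * s)), pow_one]
        have := abs_sinh_le_cosh s
        have := (Real.cosh_pos (α * s)).le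
        gcongr
    have h2 := hdecay (fun s => Real.exp (-z * Real.cosh s) * Real.sinh (α * s)) |α|
      fun s hs => by
        rw [abs_mul, Real.abs_exp]
        have := (abs_sinh_le_cosh (α * s)).trans (cosh_mul_le_exp α hs)
        gcongr
    simpa using (h1.const_mul (-z)).sub (h2.const_mul α)
  have hI : Integrable (fun s => z ^ 2 * besselKIntegrand α 2 z s - z * besselKIntegrand α 1 z s)
      (volume.restrict (Ioi 0)) := ((hint 2).const_mul (z ^ 2)).sub ((hint 1).const_mul z)
  have hI0 := (hint 0).const_mul (z ^ 2 + α ^ 2)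
  have hFTC := integral_Ioi_of_hasDerivAt_of_tendsto' (a := 0) (fun s _ => hderiv s)
    (hI.sub hI0) htend
  rw [integral_sub hI hI0, integral_sub ((hint 2).const_mul (z ^ 2)) ((hint 1).const_mul z),
    integral_const_mul, integral_const_mul, integral_const_mul] at hFTC
  simp only [Real.sinh_zero, mul_zero, zero_mul, sub_zero] at hFTC
  unfold besselKMoment
  linarith

theorem isNormalizedBessel_tildeK (m : ℝ) :
    IsNormalizedBessel m (tildeK (m / 2)) (fun z => (z / 2) ^ (-(m / 2)) *
      (-(m / 2) * besselKMoment (m / 2) 0 z - z * besselKMoment (m / 2) 1 z)) := by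
  have hpow : ∀ z : ℝ, 0 < z → HasDerivAt (fun z : ℝ => (z / 2) ^ (-(m / 2)))
      (-(m / 2) * (z / 2) ^ (-(m / 2)) / z) z := by
    intro z hz
    have hz2 : z / 2 ≠ 0 := by positivity
    refine (((hasDerivAt_id z).div_const 2).rpow_const (p := -(m / 2))
      (Or.inl hz2)).congr_deriv ?_
    simp only [id]
    rw [Real.rpow_sub_one hz2]
    field_simp
  constructor
  · intro z hz
    have hfun : tildeK (m / 2) = fun z => (z / 2) ^ (-(m / 2)) * besselKMoment (m / 2) 0 z := by
      funext z
      rw [tildeK, besselK_eq_besselKMoment]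
    rw [hfun]
    refine ((hpow z hz).mul (hasDerivAt_besselKMoment (m / 2) 0 hz)).congr_deriv ?_
    field_simp
    ring
  · intro z hz
    refine ((hpow z hz).mul (((hasDerivAt_besselKMoment (m / 2) 0 hz).const_mul (-(m / 2))).sub
      ((hasDerivAt_id z).mul (hasDerivAt_besselKMoment (m / 2) 1 hz)))).congr_deriv ?_
    rw [tildeK, besselK_eq_besselKMoment]
    have hrec := besselKMoment_recurrence (m / 2) hz
    simp only [id, one_mul, zero_add, Nat.reduceAdd, Pi.mul_apply, Pi.sub_apply]
    rw [eq_div_iff hz.ne', add_mul, mul_right_comm, div_mul_cancel₀ _ hz.ne']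
    linear_combination (z / 2) ^ (-(m / 2)) * hrec

/-! ### The partial differential equation -/

theorem quadOp_eq_of_hasDerivAt {v v₁ : ℝ → ℝ} {d y : ℝ} (a b : ℝ)
    (hv : ∀ z, 0 < z → HasDerivAt v (v₁ z / z) z) (hv₁ : HasDerivAt v₁ d y) (hy : 0 < y) :
    quadOp a b v y = y * d + b * v₁ y + a * (v₁ y + b * v y) - y ^ 2 * v y := by
  have heuler : ∀ z, 0 < z → eulerOp v z = v₁ z := fun z hz => by
    rw [eulerOp, (hv z hz).deriv, mul_div_cancel₀ _ hz.ne']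
  have hsum : (fun z => eulerOp v z + b * v z) =ᶠ[𝓝 y] fun z => v₁ z + b * v z := by
    filter_upwards [Ioi_mem_nhds hy] with z hz
    rw [heuler z hz]
  rw [quadOp, eulerOp,
    ((hv₁.add ((hv y hy).const_mul b)).congr_of_eventuallyEq hsum).deriv, heuler y hy]
  field_simp

/-- The common shape of the four generating functions. -/
def besselProduct (m n : ℝ) (A B : ℝ → ℝ) (t x : ℝ) : ℝ :=
  (1 - t) ^ (-(m + n + 2) / 2) * A (t * x / (1 - t)) * B (x / (1 - t))

section

variable {m n : ℝ} {A A₁ B B₁ : ℝ → ℝ}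

theorem hasDerivAt_comp_of_euler {f : ℝ → ℝ} {g φ' y : ℝ} (φ : ℝ → ℝ)
    (hf : HasDerivAt f (g / φ y) (φ y)) (hφ : HasDerivAt φ φ' y) :
    HasDerivAt (fun y => f (φ y)) (g * (φ' / φ y)) y :=
  (HasDerivAt.comp (h₂ := f) y hf hφ).congr_deriv (by ring)

theorem IsNormalizedBessel.hasDerivAt_scale (hA : IsNormalizedBessel m A A₁) {c d y : ℝ}
    (hc : 0 < c) (hd : 0 < d) (hy : 0 < y) :
    HasDerivAt (fun y => A (c * y / d)) (A₁ (c * y / d) / y) y ∧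
    HasDerivAt (fun y => A₁ (c * y / d))
      (((c * y / d) ^ 2 * A (c * y / d) - m * A₁ (c * y / d)) / y) y := by
  have hl : HasDerivAt (fun y : ℝ => c * y / d) (c / d) y := by
    simpa using ((hasDerivAt_id y).const_mul c).div_const d
  have hpos : 0 < c * y / d := by positivity
  have hq : c / d / (c * y / d) = 1 / y := by field_simp
  constructor
  · refine (hasDerivAt_comp_of_euler (fun y => c * y / d) (hA.hasDerivAt _ hpos) hl).congr_deriv ?_
    rw [hq, mul_one_div]
  · refine (hasDerivAt_comp_of_euler (fun y => c * y / d) (hA.hasDerivAt_euler _ hpos) hl).congr_deriv ?_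
    rw [hq, mul_one_div]

theorem Dop_besselProduct (hA : IsNormalizedBessel m A A₁) (hB : IsNormalizedBessel n B B₁)
    {t x : ℝ} (ht0 : 0 < t) (ht1 : t < 1) (hx : 0 < x) :
    Dop m n (besselProduct m n A B t) x
      = 4 * ((1 - t) ^ (-(m + n + 2) / 2) / (1 - t) ^ 2 *
        (((m + n + 2) / 2 * t * ((m + n + 2) / 2 * t + (m + 1) * (1 - t) + 1)
            + 2 * (t * x / (1 - t)) ^ 2) * (A (t * x / (1 - t)) * B (x / (1 - t)))
          + (1 + (n + 2) * t) * (A₁ (t * x / (1 - t)) * B (x / (1 - t)))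
          + (t ^ 2 + (m + 2) * t) * (A (t * x / (1 - t)) * B₁ (x / (1 - t)))
          + 2 * t * (A₁ (t * x / (1 - t)) * B₁ (x / (1 - t))))) := by
  have hσ : 0 < 1 - t := sub_pos.mpr ht1
  set c := (1 - t) ^ (-(m + n + 2) / 2) with hc
  set P : ℝ → ℝ := fun y => A (t * y / (1 - t)) with hP
  set Q : ℝ → ℝ := fun y => A₁ (t * y / (1 - t)) with hQ
  set R : ℝ → ℝ := fun y => B (1 * y / (1 - t)) with hR
  set S : ℝ → ℝ := fun y => B₁ (1 * y / (1 - t)) with hS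
  have dP : ∀ y, 0 < y → HasDerivAt P (Q y / y) y := fun y hy =>
    (hA.hasDerivAt_scale ht0 hσ hy).1
  have dQ : ∀ y, 0 < y → HasDerivAt Q (((t * y / (1 - t)) ^ 2 * P y - m * Q y) / y) y :=
    fun y hy => (hA.hasDerivAt_scale ht0 hσ hy).2
  have dR : ∀ y, 0 < y → HasDerivAt R (S y / y) y := fun y hy =>
    (hB.hasDerivAt_scale one_pos hσ hy).1
  have dS : ∀ y, 0 < y → HasDerivAt S (((1 * y / (1 - t)) ^ 2 * R y - n * S y) / y) y :=
    fun y hy => (hB.hasDerivAt_scale one_pos hσ hy).2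
  have hu : besselProduct m n A B t = fun y => c * (P y * R y) := by
    funext y
    simp only [besselProduct, hP, hR, one_mul, mul_assoc, hc]
  have hw : ∀ y, 0 < y → quadOp 0 n (besselProduct m n A B t) y
      = c * (2 * t / (1 - t) ^ 2 * (y ^ 2 * (P y * R y))
        + (n - m) * (Q y * R y) + 2 * (Q y * S y)) := by
    intro y hy
    rw [hu, quadOp_eq_of_hasDerivAt (v₁ := fun y => c * (Q y * R y + P y * S y)) 0 n
      (fun z hz => (((dP z hz).fun_mul (dR z hz)).const_mul c).congr_deriv (by field_simp))
      ((((dQ y hy).fun_mul (dR y hy)).fun_add ((dP y hy).fun_mul (dS y hy))).const_mul c) hy]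
    field_simp
    ring
  have dw : ∀ y, 0 < y → HasDerivAt (quadOp 0 n (besselProduct m n A B t))
      ((fun y => c * (2 * t / (1 - t) ^ 2 * (y ^ 2 * (2 * (P y * R y) + Q y * R y + P y * S y))
        + (n - m) * (((t / (1 - t)) ^ 2 * y ^ 2 * P y - m * Q y) * R y + Q y * S y)
        + 2 * (((t / (1 - t)) ^ 2 * y ^ 2 * P y - m * Q y) * S y
          + Q y * ((1 / (1 - t)) ^ 2 * y ^ 2 * R y - n * S y)))) y / y) y := by
    intro y hy
    have hwy : quadOp 0 n (besselProduct m n A B t) =ᶠ[𝓝 y] _ :=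
      eventually_of_mem (Ioi_mem_nhds hy) hw
    refine HasDerivAt.congr_of_eventuallyEq (HasDerivAt.congr_deriv
      ((((((hasDerivAt_pow 2 y).fun_mul ((dP y hy).fun_mul (dR y hy))).const_mul _).add
        (((dQ y hy).fun_mul (dR y hy)).const_mul _)).add
        (((dQ y hy).fun_mul (dS y hy)).const_mul _)).const_mul c) ?_) hwy
    field_simp
    ring
  have dPR := (dP x hx).fun_mul (dR x hx)
  have dQR := (dQ x hx).fun_mul (dR x hx)
  have dPS := (dP x hx).fun_mul (dS x hx)
  have dQ' := (((hasDerivAt_pow 2 x).const_mul ((t / (1 - t)) ^ 2)).fun_mul (dP x hx)).fun_sub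
    ((dQ x hx).const_mul m)
  have dS' := (((hasDerivAt_pow 2 x).const_mul ((1 / (1 - t)) ^ 2)).fun_mul (dR x hx)).fun_sub
    ((dS x hx).const_mul n)
  rw [Dop, quadOp_eq_of_hasDerivAt (m + n) m dw
    ((((((hasDerivAt_pow 2 x).fun_mul (((dPR.const_mul 2).fun_add dQR).fun_add dPS)).const_mul
      (2 * t / (1 - t) ^ 2)).fun_add (((dQ'.fun_mul (dR x hx)).fun_add ((dQ x hx).fun_mul (dS x hx))).const_mul
      (n - m))).fun_add (((dQ'.fun_mul (dS x hx)).fun_add ((dQ x hx).fun_mul dS')).const_mul 2)).const_mul c) hx,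
    hw x hx]
  simp only [hP, hQ, hR, hS, one_mul]
  generalize A (t * x / (1 - t)) = p, A₁ (t * x / (1 - t)) = q, B (x / (1 - t)) = r,
    B₁ (x / (1 - t)) = s
  field_simp
  ring

theorem besselProduct_pde (hA : IsNormalizedBessel m A A₁)
    (hB : IsNormalizedBessel n B B₁) {t x : ℝ} (ht0 : 0 < t) (ht1 : t < 1) (hx : 0 < x) :
    Dop m n (besselProduct m n A B t) x
      = 4 * eulerOp (fun s => eulerOp (fun r => besselProduct m n A B r x) s
        + (m + 1) * besselProduct m n A B s x) t := by
  set C : ℝ → ℝ := fun s => (1 - s) ^ (-(m + n + 2) / 2) with hC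
  set P : ℝ → ℝ := fun s => A (s * x / (1 - s)) with hP
  set Q : ℝ → ℝ := fun s => A₁ (s * x / (1 - s)) with hQ
  set R : ℝ → ℝ := fun s => B (x / (1 - s)) with hR
  set S : ℝ → ℝ := fun s => B₁ (x / (1 - s)) with hS
  have hsub : ∀ s : ℝ, HasDerivAt (fun s : ℝ => 1 - s) (-1) s := fun s =>
    (hasDerivAt_id s).const_sub 1
  have dC : ∀ s ∈ Ioo (0 : ℝ) 1, HasDerivAt C ((m + n + 2) / 2 * C s / (1 - s)) s := by
    intro s hs
    have h1 : 1 - s ≠ 0 := (sub_pos.mpr hs.2).ne'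
    refine ((hsub s).rpow_const (p := -(m + n + 2) / 2) (Or.inl h1)).congr_deriv ?_
    rw [Real.rpow_sub_one h1]
    ring
  have da : ∀ s ∈ Ioo (0 : ℝ) 1, HasDerivAt (fun s => s * x / (1 - s)) (x / (1 - s) ^ 2) s := by
    intro s hs
    have h1 : 1 - s ≠ 0 := (sub_pos.mpr hs.2).ne'
    refine (((hasDerivAt_id s).mul_const x).div (hsub s) h1).congr_deriv ?_
    simp only [id]
    ring
  have db : ∀ s ∈ Ioo (0 : ℝ) 1, HasDerivAt (fun s => x / (1 - s)) (x / (1 - s) ^ 2) s := by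
    intro s hs
    have h1 : 1 - s ≠ 0 := (sub_pos.mpr hs.2).ne'
    refine ((hasDerivAt_const s x).div (hsub s) h1).congr_deriv ?_
    ring
  have hqa : ∀ s ∈ Ioo (0 : ℝ) 1, ∀ g : ℝ,
      g * (x / (1 - s) ^ 2 / (s * x / (1 - s))) = g / (s * (1 - s)) := by
    intro s hs g
    have h0 : s ≠ 0 := hs.1.ne'
    have h1 : 1 - s ≠ 0 := (sub_pos.mpr hs.2).ne'
    field_simp
  have hqb : ∀ s ∈ Ioo (0 : ℝ) 1, ∀ g : ℝ,
      g * (x / (1 - s) ^ 2 / (x / (1 - s))) = g / (1 - s) := by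
    intro s hs g
    have h1 : 1 - s ≠ 0 := (sub_pos.mpr hs.2).ne'
    field_simp
  have hapos : ∀ s ∈ Ioo (0 : ℝ) 1, 0 < s * x / (1 - s) := fun s hs =>
    div_pos (mul_pos hs.1 hx) (sub_pos.mpr hs.2)
  have hbpos : ∀ s ∈ Ioo (0 : ℝ) 1, 0 < x / (1 - s) := fun s hs =>
    div_pos hx (sub_pos.mpr hs.2)
  have dP : ∀ s ∈ Ioo (0 : ℝ) 1, HasDerivAt P (Q s / (s * (1 - s))) s := fun s hs =>
    (hasDerivAt_comp_of_euler (fun s => s * x / (1 - s)) (hA.hasDerivAt _ (hapos s hs)) (da s hs)).congr_deriv (hqa s hs _)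
  have dQ : ∀ s ∈ Ioo (0 : ℝ) 1, HasDerivAt Q
      (((s * x / (1 - s)) ^ 2 * P s - m * Q s) / (s * (1 - s))) s := fun s hs =>
    (hasDerivAt_comp_of_euler (fun s => s * x / (1 - s)) (hA.hasDerivAt_euler _ (hapos s hs)) (da s hs)).congr_deriv
      (hqa s hs _)
  have dR : ∀ s ∈ Ioo (0 : ℝ) 1, HasDerivAt R (S s / (1 - s)) s := fun s hs =>
    (hasDerivAt_comp_of_euler (fun s => x / (1 - s)) (hB.hasDerivAt _ (hbpos s hs)) (db s hs)).congr_deriv (hqb s hs _)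
  have dS : ∀ s ∈ Ioo (0 : ℝ) 1, HasDerivAt S
      (((x / (1 - s)) ^ 2 * R s - n * S s) / (1 - s)) s := fun s hs =>
    (hasDerivAt_comp_of_euler (fun s => x / (1 - s)) (hB.hasDerivAt_euler _ (hbpos s hs)) (db s hs)).congr_deriv
      (hqb s hs _)
  have hu : ∀ s, besselProduct m n A B s x = C s * (P s * R s) := fun s => by
    simp only [besselProduct, hC, hP, hR, mul_assoc]
  have hsum : ∀ s ∈ Ioo (0 : ℝ) 1, eulerOp (fun r => besselProduct m n A B r x) s
        + (m + 1) * besselProduct m n A B s x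
      = C s * (((m + n + 2) / 2 * (s / (1 - s)) + (m + 1)) * (P s * R s)
        + 1 / (1 - s) * (Q s * R s) + s / (1 - s) * (P s * S s)) := by
    intro s hs
    have h0 : s ≠ 0 := hs.1.ne'
    have h1 : 1 - s ≠ 0 := (sub_pos.mpr hs.2).ne'
    rw [funext hu, hu, eulerOp, ((dC s hs).fun_mul ((dP s hs).fun_mul (dR s hs))).deriv]
    field_simp
    ring
  have ht : t ∈ Ioo (0 : ℝ) 1 := ⟨ht0, ht1⟩
  have h1 : 1 - t ≠ 0 := (sub_pos.mpr ht1).ne'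
  have dinv : HasDerivAt (fun s : ℝ => 1 / (1 - s)) (1 / (1 - t) ^ 2) t :=
    ((hasDerivAt_const t (1 : ℝ)).div (hsub t) h1).congr_deriv (by ring)
  have dfrac : HasDerivAt (fun s : ℝ => s / (1 - s)) (1 / (1 - t) ^ 2) t :=
    ((hasDerivAt_id t).div (hsub t) h1).congr_deriv (by simp only [id]; ring)
  have hev := eventually_of_mem (Ioo_mem_nhds ht0 ht1) hsum
  have hderiv := HasDerivAt.congr_of_eventuallyEq ((dC t ht).mul
    ((((dfrac.const_mul ((m + n + 2) / 2)).add_const (m + 1)).fun_mul ((dP t ht).fun_mul (dR t ht))).fun_add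
      (dinv.fun_mul ((dQ t ht).fun_mul (dR t ht))) |>.fun_add (dfrac.fun_mul ((dP t ht).fun_mul (dS t ht))))) hev
  rw [eulerOp, hderiv.deriv, Dop_besselProduct hA hB ht0 ht1 hx]
  simp only [hC, hP, hQ, hR, hS]
  generalize A (t * x / (1 - t)) = p, A₁ (t * x / (1 - t)) = q, B (x / (1 - t)) = r,
    B₁ (x / (1 - t)) = s, (1 - t) ^ (-(m + n + 2) / 2) = c
  field_simp
  ring

end

/-- Each generating function `u(t,x) = G_i^{μ,ν}(t,x)` (`i = 1,2,3,4`) satisfies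
`(D_{μ,ν})ₓ u = 4·θ_t(θ_t + μ + 1) u` for `0 < t < 1`, `x > 0`. -/
theorem statement3 (μ ν t x : ℝ) (ht0 : 0 < t) (ht1 : t < 1) (hx : 0 < x) :
    (Dop μ ν (fun y => genG₁ μ ν t y) x
      = 4 * eulerOp (fun s => eulerOp (fun r => genG₁ μ ν r x) s + (μ + 1) * genG₁ μ ν s x) t) ∧
    (Dop μ ν (fun y => genG₂ μ ν t y) x
      = 4 * eulerOp (fun s => eulerOp (fun r => genG₂ μ ν r x) s + (μ + 1) * genG₂ μ ν s x) t) ∧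
    (Dop μ ν (fun y => genG₃ μ ν t y) x
      = 4 * eulerOp (fun s => eulerOp (fun r => genG₃ μ ν r x) s + (μ + 1) * genG₃ μ ν s x) t) ∧
    (Dop μ ν (fun y => genG₄ μ ν t y) x
      = 4 * eulerOp (fun s => eulerOp (fun r => genG₄ μ ν r x) s + (μ + 1) * genG₄ μ ν s x) t) := by
  have hI := isNormalizedBessel_tildeI
  have hK := isNormalizedBessel_tildeK
  exact ⟨besselProduct_pde (hI μ) (hI ν) ht0 ht1 hx, besselProduct_pde (hI μ) (hK ν) ht0 ht1 hx,
    besselProduct_pde (hK μ) (hI ν) ht0 ht1 hx, besselProduct_pde (hK μ) (hK ν) ht0 ht1 hx⟩
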